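/- If h is a game state in which every height h_i is even, then h is not a first-player win in the reversed Zeckendorf game; that is, the player moving second from h has a winning strategy. -/

import Mathlib

/-- The Fibonacci numbers indexed so that `zfib 1 = 1`, `zfib 2 = 2`,
and `zfib (i+1) = zfib i + zfib (i-1)`. -/
def zfib (i : ℕ) : ℕ := Nat.fib (i + 1)

/-- A game state: a finitely supported function recording the height of each bin.
Bin indices start at `1`; index `0` is unused. -/
abbrev ZState := ℕ →₀ ℕ

/-- The legal moves of the reversed Zeckendorf game. -/
inductive ZMove : ZState → ZState → Prop
  | split (h : ZState) (i : ℕ) (hi : 2 ≤ i) (hpos : 0 < h (i + 1)) :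
      ZMove h (h - Finsupp.single (i + 1) 1 + Finsupp.single i 1 + Finsupp.single (i - 1) 1)
  | splitTwo (h : ZState) (hpos : 0 < h 2) :
      ZMove h (h - Finsupp.single 2 1 + Finsupp.single 1 2)
  | combine (h : ZState) (i : ℕ) (hi : 2 < i) (h1 : 0 < h (i + 1)) (h2 : 0 < h (i - 2)) :
      ZMove h (h - Finsupp.single (i + 1) 1 - Finsupp.single (i - 2) 1 + Finsupp.single i 2)
  | combineTwo (h : ZState) (h1 : 0 < h 3) (h2 : 0 < h 1) :
      ZMove h (h - Finsupp.single 3 1 - Finsupp.single 1 1 + Finsupp.single 2 2)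

mutual
  /-- The state is a first-player win: some legal move leads to a state that is a
  loss for the player then to move. -/
  inductive ZFirstWin : ZState → Prop
    | intro (h h' : ZState) (m : ZMove h h') (hl : ZLoss h') : ZFirstWin h
  /-- The state is a loss for the player to move (i.e., not a first-player win):
  every legal move leads to a first-player win for the opponent. -/
  inductive ZLoss : ZState → Prop
    | intro (h : ZState) (hall : ∀ h', ZMove h h' → ZFirstWin h') : ZLoss h
end

theorem zcopy (h h' : ZState) (m : ZMove h h') (he : ∀ i, Even (h i)) :
    ∃ h'', ZMove h' h'' ∧ ∀ i, Even (h'' i) := by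
  cases m with
  | split i hi hpos =>
    refine ⟨_, ZMove.split _ i hi ?_, ?_⟩
    · have := he (i+1)
      simp only [Finsupp.add_apply, Finsupp.tsub_apply, Finsupp.single_apply]
      grind
    · intro j
      have := he j
      simp only [Finsupp.add_apply, Finsupp.tsub_apply, Finsupp.single_apply]
      grind
  | splitTwo hpos =>
    refine ⟨_, ZMove.splitTwo _ ?_, ?_⟩
    · have := he 2
      simp only [Finsupp.add_apply, Finsupp.tsub_apply, Finsupp.single_apply]
      grind
    · intro j
      have := he j
      simp only [Finsupp.add_apply, Finsupp.tsub_apply, Finsupp.single_apply]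
      grind
  | combine i hi h1 h2 =>
    refine ⟨_, ZMove.combine _ i hi ?_ ?_, ?_⟩
    · have := he (i+1)
      simp only [Finsupp.add_apply, Finsupp.tsub_apply, Finsupp.single_apply]
      grind
    · have := he (i-2)
      simp only [Finsupp.add_apply, Finsupp.tsub_apply, Finsupp.single_apply]
      grind
    · intro j
      have := he j
      simp only [Finsupp.add_apply, Finsupp.tsub_apply, Finsupp.single_apply]
      grind
  | combineTwo h1 h2 =>
    refine ⟨_, ZMove.combineTwo _ ?_ ?_, ?_⟩
    · have := he 3
      simp only [Finsupp.add_apply, Finsupp.tsub_apply, Finsupp.single_apply]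
      grind
    · have := he 1
      simp only [Finsupp.add_apply, Finsupp.tsub_apply, Finsupp.single_apply]
      grind
    · intro j
      have := he j
      simp only [Finsupp.add_apply, Finsupp.tsub_apply, Finsupp.single_apply]
      grind

/-- If every height of a game state is even, then the state is not a first-player
win in the reversed Zeckendorf game: the player moving second has a winning
strategy. -/
theorem reversedZeckendorf_all_even_not_firstPlayerWin (h : ZState)
    (h0 : h 0 = 0) (heven : ∀ i, Even (h i)) : ¬ ZFirstWin h := by
  intro hw
  refine ZFirstWin.rec (motive_1 := fun h _ => (∀ i, Even (h i)) → False)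
    (motive_2 := fun h _ => ∀ h'', ZMove h h'' → (∀ i, Even (h'' i)) → False)
    ?_ ?_ hw heven
  · intro h h' m _ ih he
    obtain ⟨h'', m', he'⟩ := zcopy h h' m he
    exact ih h'' m' he'
  · intro h _ ih h'' m he
    exact ih h'' m he
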